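/- Let l ≥ 0 be an integer, let a, b ∈ ℤ, and let f, g ∈ ℤ[t]. If a·(1−D) = (2+A−2D−2B)^l · (b·D + f(A) + B·g(A)) in R, then g = 0, f is the constant polynomial −b, and a = −2^{2l}·b; in particular 2^{2l} divides a. -/

import Mathlib

noncomputable section

open MvPolynomial

abbrev PDab : Type := MvPolynomial (Fin 3) ℤ

/-- Relations `D² − 1`, `D·A − A`, `D·B − B`, `B² − 4(A − 2B)` with `D, A, B = X 0, X 1, X 2`. -/
def relsDAB : Set PDab :=
  {X 0 ^ 2 - 1, X 0 * X 1 - X 1, X 0 * X 2 - X 2, X 2 ^ 2 - 4 * (X 1 - 2 * X 2)}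

/-- The ring `ℤ[D,A,B]/(D²−1, D·A−A, D·B−B, B²−4(A−2B))`, i.e. `RO(Pin(2))`. -/
abbrev RO : Type := PDab ⧸ Ideal.span relsDAB

def Dv : RO := Ideal.Quotient.mk (Ideal.span relsDAB) (X 0)
def Av : RO := Ideal.Quotient.mk (Ideal.span relsDAB) (X 1)
def Bv : RO := Ideal.Quotient.mk (Ideal.span relsDAB) (X 2)

lemma exists_hom {S : Type} [CommRing S] (d x y : S) (h1 : d ^ 2 - 1 = 0) (h2 : d * x - x = 0)
    (h3 : d * y - y = 0) (h4 : y ^ 2 - 4 * (x - 2 * y) = 0) :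
    ∃ φ : RO →+* S, φ Dv = d ∧ φ Bv = y ∧
      ∀ p : Polynomial ℤ, φ (Polynomial.aeval Av p) = p.eval₂ (Int.castRingHom S) x ∧
      φ Av = x := by
  have key : ∀ p ∈ Ideal.span relsDAB, (aeval (R := ℤ) ![d, x, y]).toRingHom p = 0 := by
    intro p hp
    have hle : Ideal.span relsDAB ≤ RingHom.ker (aeval (R := ℤ) ![d, x, y]).toRingHom := by
      rw [Ideal.span_le]
      rintro q (rfl | rfl | rfl | rfl) <;>
        simp [RingHom.mem_ker, h1, h2, h3, h4]
    exact hle hp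
  have hA : Ideal.Quotient.lift _ _ key Av = x := by
    change (aeval (R := ℤ) ![d, x, y]) (X 1) = x
    simp
  refine ⟨Ideal.Quotient.lift _ _ key, ?_, ?_, fun p => ⟨?_, hA⟩⟩
  · change (aeval (R := ℤ) ![d, x, y]) (X 0) = d
    simp
  · change (aeval (R := ℤ) ![d, x, y]) (X 2) = y
    simp
  · rw [Polynomial.aeval_def, Polynomial.hom_eval₂, hA]
    congr 1
    exact RingHom.ext_int _ _

/-- core of Lemma 7.5. If
`a·(1−D) = (2+A−2D−2B)^l · (b·D + f(A) + B·g(A))` in `R`, then `g = 0`, `f` is the constant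
polynomial `−b`, and `a = −2^{2l}·b`; in particular `2^{2l} ∣ a`. -/
theorem lemma_7_5_core (l : ℕ) (a b : ℤ) (f g : Polynomial ℤ)
    (hyp : (a : RO) * (1 - Dv) =
      (2 + Av - 2 * Dv - 2 * Bv) ^ l *
        ((b : RO) * Dv + Polynomial.aeval Av f + Bv * Polynomial.aeval Av g)) :
    g = 0 ∧ f = Polynomial.C (-b) ∧ a = -(2 ^ (2 * l)) * b ∧ (2 : ℤ) ^ (2 * l) ∣ a := by
  obtain ⟨φ, hD, hB, hP⟩ := exists_hom (S := Polynomial ℤ) 1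
    (Polynomial.X ^ 2 + 4 * Polynomial.X) (2 * Polynomial.X)
    (by ring) (by ring) (by ring) (by ring)
  obtain ⟨ψ, kD, kB, kP⟩ := exists_hom (S := ℤ) (-1) 0 0
    (by ring) (by ring) (by ring) (by ring)
  have hA := (hP 0).2
  have kA := (kP 0).2
  replace hP : ∀ p, _ := fun p => (hP p).1
  replace kP : ∀ p, _ := fun p => (kP p).1
  have e1 := congrArg φ hyp
  have e2 := congrArg ψ hyp
  simp only [map_mul, map_add, map_sub, map_pow, map_one, map_intCast, map_ofNat,
    hP, hD, hA, hB] at e1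
  simp only [map_mul, map_add, map_sub, map_pow, map_one, map_intCast, map_ofNat,
    kP, kD, kA, kB] at e2
  have hc : ∀ p r : Polynomial ℤ, p.eval₂ (Int.castRingHom (Polynomial ℤ)) r = p.comp r := by
    intro p r
    rw [Polynomial.comp, RingHom.ext_int (Int.castRingHom (Polynomial ℤ)) Polynomial.C]
  rw [hc, hc] at e1
  set q : Polynomial ℤ := Polynomial.X ^ 2 + 4 * Polynomial.X with hq
  have hz : (2 + q - 2 * 1 - 2 * (2 * Polynomial.X) : Polynomial ℤ) = Polynomial.X ^ 2 := by
    rw [hq]; ring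
  rw [hz, sub_self, mul_zero] at e1
  have e3 : (b : Polynomial ℤ) * 1 + f.comp q + 2 * Polynomial.X * g.comp q = 0 :=
    (mul_eq_zero.mp e1.symm).resolve_left (by simp)
  have hs : q.comp (-4 - Polynomial.X) = q := by
    simp only [hq, Polynomial.add_comp, Polynomial.pow_comp, Polynomial.mul_comp,
      Polynomial.X_comp, Polynomial.ofNat_comp]
    ring
  have e4 := congrArg (fun p : Polynomial ℤ => p.comp (-4 - Polynomial.X)) e3
  simp only [Polynomial.add_comp, Polynomial.mul_comp, Polynomial.intCast_comp,
    Polynomial.one_comp, Polynomial.ofNat_comp, Polynomial.X_comp, Polynomial.comp_assoc, hs,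
    Polynomial.zero_comp] at e4
  have e5 : (4 * Polynomial.X + 8 : Polynomial ℤ) * g.comp q = 0 := by
    linear_combination e3 - e4
  have hne : (4 * Polynomial.X + 8 : Polynomial ℤ) ≠ 0 := by
    intro h
    have := congrArg (Polynomial.eval 0) h
    simp at this
  have hqd : ∀ p : Polynomial ℤ, p.comp q = 0 → p = 0 := by
    intro p hp
    rcases Polynomial.comp_eq_zero_iff.mp hp with h | ⟨_, h⟩
    · exact h
    · exfalso
      have h0 := congrArg (Polynomial.eval 1) h
      have h1 := congrArg (Polynomial.eval 0) h
      simp [hq] at h0 h1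
  have hg0 := (mul_eq_zero.mp e5).resolve_left hne
  have hg : g = 0 := hqd g hg0
  have hf : f = Polynomial.C (-b) := by
    have : f + (b : Polynomial ℤ) = 0 := by
      apply hqd
      simp only [Polynomial.add_comp, Polynomial.intCast_comp]
      linear_combination e3 - 2 * Polynomial.X * hg0
    rw [eq_neg_of_add_eq_zero_left this]
    simp
  have ha : a = -(2 ^ (2 * l)) * b := by
    subst hf
    simp only [Polynomial.eval₂_C] at e2
    norm_num at e2
    rw [pow_mul]
    norm_num
    linarith
  exact ⟨hg, hf, ha, ha ▸ ⟨-b, by ring⟩⟩
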